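/- arXiv:math/0702166 — 6 statements merged into one kernel-verified Lean document; each statement's English description precedes it below -/
import Mathlib

section
/- For every n ≥ 5, the sequence π_1 = ((n−1)^2, 2^{n−2}), consisting of two terms equal to n−1 followed by n−2 terms equal to 2, is graphic, satisfies σ(π_1) = 4n − 6, and is not potentially (K_5 − P_4)-graphic. -/
/-- The multiset of vertex degrees of a simple graph on `Fin n`. -/
noncomputable def degMS {n : ℕ} (G : SimpleGraph (Fin n)) : Multiset ℕ :=
  Finset.univ.val.map fun v => Nat.card {w // G.Adj v w}

/-- A list of naturals is graphic if it is the degree sequence (as a multiset)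
of a simple graph on `π.length` vertices. -/
def IsGraphic (π : List ℕ) : Prop :=
  ∃ G : SimpleGraph (Fin π.length), degMS G = ↑π

/-- `π` is potentially `H`-graphic: some realization of `π` contains a copy of `H`. -/
def Potentially {β : Type} (H : SimpleGraph β) (π : List ℕ) : Prop :=
  ∃ G : SimpleGraph (Fin π.length), degMS G = ↑π ∧
    ∃ f : β → Fin π.length, Function.Injective f ∧
      ∀ u v : β, H.Adj u v → G.Adj (f u) (f v)

/-- `K₅ - P₄`: complete graph on 5 vertices minus the edges of a path on 4 vertices. -/
def K5P4 : SimpleGraph (Fin 5) :=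
  (⊤ : SimpleGraph (Fin 5)) \ SimpleGraph.fromEdgeSet {s(0, 1), s(1, 2), s(2, 3)}

/-- `K₅ - Y₄`: complete graph on 5 vertices minus the edges of the tree `Y₄`
on 5 vertices with 3 leaves (star `K_{1,3}` with one edge subdivided):
edges `{0,1}, {0,2}, {0,3}, {3,4}`. -/
def K5Y4 : SimpleGraph (Fin 5) :=
  (⊤ : SimpleGraph (Fin 5)) \ SimpleGraph.fromEdgeSet {s(0, 1), s(0, 2), s(0, 3), s(3, 4)}

theorem aux_graphic (m : ℕ) : ∃ G : SimpleGraph (Fin (m + 2)),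
    degMS G = ↑((m + 1) :: (m + 1) :: List.replicate m 2) := by
  classical
  let G : SimpleGraph (Fin (m + 2)) :=
    { Adj := fun u v => u ≠ v ∧ (u.val < 2 ∨ v.val < 2)
      symm := ⟨fun u v h => ⟨h.1.symm, h.2.symm⟩⟩
      loopless := ⟨fun u h => h.1 rfl⟩ }
  have h1 : ∀ v : Fin (m + 2), v.val < 2 → Nat.card {w // G.Adj v w} = m + 1 := by
    intro v hv
    rw [Nat.card_eq_fintype_card, Fintype.card_subtype]
    have : Finset.univ.filter (fun w => G.Adj v w) = Finset.univ.erase v := by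
      ext w
      simp only [Finset.mem_filter, Finset.mem_univ, true_and, Finset.mem_erase, and_true]
      exact ⟨fun h => h.1.symm, fun h => ⟨h.symm, Or.inl hv⟩⟩
    rw [this]
    simp
  have h2 : ∀ v : Fin (m + 2), 2 ≤ v.val → Nat.card {w // G.Adj v w} = 2 := by
    intro v hv
    rw [Nat.card_eq_fintype_card, Fintype.card_subtype]
    have : Finset.univ.filter (fun w => G.Adj v w) = {0, 1} := by
      ext w
      simp only [Finset.mem_filter, Finset.mem_univ, true_and, Finset.mem_insert,
        Finset.mem_singleton, Fin.ext_iff, Fin.val_zero, Fin.val_one]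
      constructor
      · rintro ⟨_, h | h⟩ <;> omega
      · intro h
        refine ⟨fun e => ?_, Or.inr (by omega)⟩
        subst e
        omega
    rw [this]
    exact Finset.card_pair (by simp [Fin.ext_iff])
  refine ⟨G, ?_⟩
  unfold degMS
  rw [Fin.univ_val_map, List.ofFn_succ, List.ofFn_succ, h1 _ (by simp), h1 _ (by simp)]
  have : (fun i : Fin m => Nat.card {w // G.Adj i.succ.succ w}) = fun _ => 2 := by
    funext i
    exact h2 _ (by simp)
  rw [this, List.ofFn_const]

theorem aux_transport (π : List ℕ) (k : ℕ) (h : π.length = k)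
    (hG : ∃ G : SimpleGraph (Fin k), degMS G = ↑π) : IsGraphic π := by
  subst h
  exact hG

theorem aux_deg {N : ℕ} (G : SimpleGraph (Fin N)) (v a b c : Fin N) (hab : a ≠ b) (hac : a ≠ c)
    (hbc : b ≠ c) (ha : G.Adj v a) (hb : G.Adj v b) (hc : G.Adj v c) :
    2 < Nat.card {w // G.Adj v w} := by
  classical
  rw [Nat.card_eq_fintype_card, Fintype.card_subtype, Finset.two_lt_card]
  exact ⟨a, by simpa, b, by simpa, c, by simpa, hab, hac, hbc⟩

theorem extremal_K5P4 (n : ℕ) (hn : 5 ≤ n) :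
    IsGraphic ((n - 1) :: (n - 1) :: List.replicate (n - 2) 2) ∧
    ((n - 1) :: (n - 1) :: List.replicate (n - 2) 2).sum = 4 * n - 6 ∧
    ¬ Potentially K5P4 ((n - 1) :: (n - 1) :: List.replicate (n - 2) 2) := by
  classical
  refine ⟨?_, ?_, ?_⟩
  · obtain ⟨m, rfl⟩ : ∃ m, n = m + 2 := ⟨n - 2, by omega⟩
    exact aux_transport _ (m + 2) (by simp) (aux_graphic m)
  · simp only [List.sum_cons, List.sum_replicate, smul_eq_mul]
    omega
  · rintro ⟨G, hG, f, hf, hadj⟩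
    have hc := congrArg (Multiset.countP (fun d => 2 < d)) hG
    have hr : Multiset.countP (fun d => 2 < d)
        (((n - 1) :: (n - 1) :: List.replicate (n - 2) 2 : List ℕ) : Multiset ℕ) ≤ 2 := by
      rw [Multiset.coe_countP, List.countP_cons, List.countP_cons, List.countP_replicate]
      simp only [lt_irrefl, decide_false]
      split_ifs <;> simp_all
    rw [← hc] at hr
    unfold degMS at hr
    rw [Multiset.countP_map] at hr
    have hA : ∀ u v : Fin 5, (u ≠ v ∧ s(u, v) ≠ s(0, 1) ∧ s(u, v) ≠ s(1, 2) ∧ s(u, v) ≠ s(2, 3)) →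
        G.Adj (f u) (f v) := by
      rintro u v ⟨h0, h1, h2, h3⟩
      apply hadj
      simp only [K5P4, SimpleGraph.sdiff_adj, SimpleGraph.top_adj, SimpleGraph.fromEdgeSet_adj,
        Set.mem_insert_iff, Set.mem_singleton_iff]
      tauto
    have d0 := aux_deg G (f 0) (f 2) (f 3) (f 4) (hf.ne (by decide)) (hf.ne (by decide))
      (hf.ne (by decide)) (hA _ _ (by decide)) (hA _ _ (by decide)) (hA _ _ (by decide))
    have d3 := aux_deg G (f 3) (f 0) (f 1) (f 4) (hf.ne (by decide)) (hf.ne (by decide))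
      (hf.ne (by decide)) (hA _ _ (by decide)) (hA _ _ (by decide)) (hA _ _ (by decide))
    have d4 := aux_deg G (f 4) (f 0) (f 1) (f 2) (hf.ne (by decide)) (hf.ne (by decide))
      (hf.ne (by decide)) (hA _ _ (by decide)) (hA _ _ (by decide)) (hA _ _ (by decide))
    have h3 : 2 < (Finset.univ.filter (fun v => 2 < Nat.card {w // G.Adj v w})).card := by
      rw [Finset.two_lt_card]
      refine ⟨f 0, ?_, f 3, ?_, f 4, ?_, hf.ne (by decide), hf.ne (by decide), hf.ne (by decide)⟩
      · exact Finset.mem_filter.2 ⟨Finset.mem_univ _, d0⟩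
      · exact Finset.mem_filter.2 ⟨Finset.mem_univ _, d3⟩
      · exact Finset.mem_filter.2 ⟨Finset.mem_univ _, d4⟩
    rw [Finset.card_def, Finset.filter_val] at h3
    exact absurd h3 (not_lt.2 hr)
end

section
/- For every n ≥ 5, the sequence π_1 = ((n−1)^2, 2^{n−2}), consisting of two terms equal to n−1 followed by n−2 terms equal to 2, is graphic, satisfies σ(π_1) = 4n − 6, and is not potentially (K_5 − Y_4)-graphic. -/
lemma aux_graph (N m : ℕ) (h : N = m + 2) :
    ∃ G : SimpleGraph (Fin N), degMS G = ↑((m + 1) :: (m + 1) :: List.replicate m 2) := by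
  subst h
  let G : SimpleGraph (Fin (m + 2)) :=
    { Adj := fun u v => u ≠ v ∧ (u.val < 2 ∨ v.val < 2)
      symm := ⟨fun u v h => ⟨h.1.symm, h.2.symm⟩⟩
      loopless := ⟨fun u h => h.1 rfl⟩ }
  have hA : ∀ u v, G.Adj u v ↔ u ≠ v ∧ (u.val < 2 ∨ v.val < 2) := fun _ _ => Iff.rfl
  have hbig : ∀ v : Fin (m + 2), v.val < 2 → Nat.card {w // G.Adj v w} = m + 1 := by
    intro v hv
    have : ∀ w, G.Adj v w ↔ w ≠ v := by
      intro w
      rw [hA]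
      constructor
      · exact fun h => h.1.symm
      · exact fun h => ⟨h.symm, Or.inl hv⟩
    simp only [this]
    rw [Nat.card_eq_fintype_card, Fintype.card_subtype_compl]
    simp
  have hsmall : ∀ v : Fin (m + 2), ¬ v.val < 2 → Nat.card {w // G.Adj v w} = 2 := by
    intro v hv
    have : ∀ w, G.Adj v w ↔ w ∈ ({0, 1} : Finset (Fin (m + 2))) := by
      intro w
      rw [hA]
      simp only [Finset.mem_insert, Finset.mem_singleton, Fin.ext_iff, Fin.val_zero, Fin.val_one,
        ne_eq]
      omega
    simp only [this]
    rw [Nat.card_eq_fintype_card, Fintype.card_coe, Finset.card_pair]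
    simp
  refine ⟨G, ?_⟩
  have h1 : degMS G = ↑(List.ofFn fun v => Nat.card {w // G.Adj v w}) := by
    unfold degMS
    rw [List.ofFn_eq_map, ← Multiset.map_coe]
    rfl
  rw [h1, List.ofFn_succ, List.ofFn_succ, hbig _ (by simp), hbig _ (by simp)]
  have : (fun i : Fin m => Nat.card {w // G.Adj i.succ.succ w}) = fun _ => 2 := by
    funext i
    exact hsmall _ (by simp)
  rw [this, List.ofFn_const]

theorem extremal_K5Y4 (n : ℕ) (hn : 5 ≤ n) :
    IsGraphic ((n - 1) :: (n - 1) :: List.replicate (n - 2) 2) ∧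
    ((n - 1) :: (n - 1) :: List.replicate (n - 2) 2).sum = 4 * n - 6 ∧
    ¬ Potentially K5Y4 ((n - 1) :: (n - 1) :: List.replicate (n - 2) 2) := by
  refine ⟨?_, ?_, ?_⟩
  · have h := aux_graph ((n - 1) :: (n - 1) :: List.replicate (n - 2) 2).length (n - 2) (by simp)
    have e : n - 2 + 1 = n - 1 := by omega
    rw [e] at h
    exact h
  · simp
    omega
  · rintro ⟨G, hG, f, hf, hadj⟩
    have hc := congrArg (Multiset.countP (fun d => 3 ≤ d)) hG
    have hr : Multiset.countP (fun d => 3 ≤ d)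
        (((n - 1) :: (n - 1) :: List.replicate (n - 2) 2 : List ℕ) : Multiset ℕ) ≤ 2 := by
      rw [Multiset.coe_countP, List.countP_cons, List.countP_cons, List.countP_replicate]
      simp
      split_ifs <;> omega
    have key : ∀ a b c d : Fin 5, K5Y4.Adj a b → K5Y4.Adj a c → K5Y4.Adj a d →
        b ≠ c → b ≠ d → c ≠ d → 3 ≤ Nat.card {w // G.Adj (f a) w} := by
      intro a b c d hb hc hd h1 h2 h3
      classical
      rw [Nat.card_eq_fintype_card, Fintype.card_subtype]
      have : ({f b, f c, f d} : Finset _) ⊆ Finset.univ.filter (fun w => G.Adj (f a) w) := by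
        intro w hw
        simp only [Finset.mem_insert, Finset.mem_singleton] at hw
        rcases hw with rfl | rfl | rfl <;> simp [hadj _ _ hb, hadj _ _ hc, hadj _ _ hd]
      refine le_trans (le_of_eq ?_) (Finset.card_le_card this)
      rw [Finset.card_eq_three.2 ⟨_, _, _, hf.ne h1, hf.ne h2, hf.ne h3, rfl⟩]
    have k1 := key 1 2 3 4 (by simp [K5Y4]) (by simp [K5Y4]) (by simp [K5Y4])
      (by decide) (by decide) (by decide)
    have k2 := key 2 1 3 4 (by simp [K5Y4]) (by simp [K5Y4]) (by simp [K5Y4])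
      (by decide) (by decide) (by decide)
    have k4 := key 4 0 1 2 (by simp [K5Y4]) (by simp [K5Y4]) (by simp [K5Y4])
      (by decide) (by decide) (by decide)
    have hl : 3 ≤ Multiset.countP (fun d => 3 ≤ d) (degMS G) := by
      unfold degMS
      rw [Multiset.countP_map]
      have : ({f 1, f 2, f 4} : Finset _) ⊆
          Finset.univ.filter (fun v => 3 ≤ Nat.card {w // G.Adj v w}) := by
        intro w hw
        simp only [Finset.mem_insert, Finset.mem_singleton] at hw
        rw [Finset.mem_filter]
        rcases hw with rfl | rfl | rfl
        exacts [⟨Finset.mem_univ _, k1⟩, ⟨Finset.mem_univ _, k2⟩, ⟨Finset.mem_univ _, k4⟩]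
      refine le_trans (le_of_eq ?_) (Finset.card_le_card this)
      rw [Finset.card_eq_three.2 ⟨_, _, _, hf.ne (by decide), hf.ne (by decide),
        hf.ne (by decide), rfl⟩]
    omega
end

section
/- Let n ≥ 5 and let k, t ∈ {3, 4, ..., n−2} be such that k and t have different parities. Then the sequence π = (n−1, k, 2^t, 1^{n−2−t}) is not potentially (K_5 − P_4)-graphic. -/
theorem three_le_card_nbr {m : ℕ} (G : SimpleGraph (Fin m)) (v a b c : Fin m)
    (ha : G.Adj v a) (hb : G.Adj v b) (hc : G.Adj v c)
    (hab : a ≠ b) (hac : a ≠ c) (hbc : b ≠ c) :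
    3 ≤ Nat.card {w // G.Adj v w} := by
  classical
  rw [Nat.card_eq_fintype_card, Fintype.card_subtype]
  have h3 : ({a, b, c} : Finset (Fin m)).card = 3 := Finset.card_eq_three.2
    ⟨a, b, c, hab, hac, hbc, rfl⟩
  rw [← h3]
  apply Finset.card_le_card
  intro x hx
  simp only [Finset.mem_insert, Finset.mem_singleton] at hx
  simp only [Finset.mem_filter, Finset.mem_univ, true_and]
  rcases hx with rfl | rfl | rfl <;> assumption

theorem not_potentially_K5P4_family1 (n k t : ℕ) (hn : 5 ≤ n)
    (hk1 : 3 ≤ k) (hk2 : k ≤ n - 2) (ht1 : 3 ≤ t) (ht2 : t ≤ n - 2)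
    (hpar : k % 2 ≠ t % 2) :
    ¬ Potentially K5P4
      ((n - 1) :: k :: (List.replicate t 2 ++ List.replicate (n - 2 - t) 1)) := by
  classical
  rintro ⟨G, hG, f, hf, hadj⟩
  have hcount := congrArg (Multiset.countP (fun d => 3 ≤ d)) hG
  have hr : Multiset.countP (fun d => 3 ≤ d)
      (((n - 1) :: k :: (List.replicate t 2 ++ List.replicate (n - 2 - t) 1) : List ℕ) :
        Multiset ℕ) ≤ 2 := by
    rw [Multiset.coe_countP]
    simp only [List.countP_cons, List.countP_append, List.countP_replicate]
    simp
    split_ifs <;> omega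
  have hl : 3 ≤ Multiset.countP (fun d => 3 ≤ d) (degMS G) := by
    unfold degMS
    rw [Multiset.countP_map]
    have h3 : ({f 0, f 3, f 4} : Finset _).card = 3 := Finset.card_eq_three.2
      ⟨f 0, f 3, f 4, hf.ne (by decide), hf.ne (by decide), hf.ne (by decide), rfl⟩
    have key : ({f 0, f 3, f 4} : Finset _) ⊆
        Finset.univ.filter (fun v => 3 ≤ Nat.card {w // G.Adj v w}) := by
      intro x hx
      simp only [Finset.mem_insert, Finset.mem_singleton] at hx
      simp only [Finset.mem_filter, Finset.mem_univ, true_and]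
      rcases hx with rfl | rfl | rfl
      · exact three_le_card_nbr G _ (f 2) (f 3) (f 4)
          (hadj _ _ (by simp [K5P4])) (hadj _ _ (by simp [K5P4])) (hadj _ _ (by simp [K5P4]))
          (hf.ne (by decide)) (hf.ne (by decide)) (hf.ne (by decide))
      · exact three_le_card_nbr G _ (f 0) (f 1) (f 4)
          (hadj _ _ (by simp [K5P4])) (hadj _ _ (by simp [K5P4])) (hadj _ _ (by simp [K5P4]))
          (hf.ne (by decide)) (hf.ne (by decide)) (hf.ne (by decide))
      · exact three_le_card_nbr G _ (f 0) (f 1) (f 2)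
          (hadj _ _ (by simp [K5P4])) (hadj _ _ (by simp [K5P4])) (hadj _ _ (by simp [K5P4]))
          (hf.ne (by decide)) (hf.ne (by decide)) (hf.ne (by decide))
    have := Finset.card_le_card key
    rw [h3] at this
    exact this
  omega
end

section
/- For every odd n ≥ 7, the n-term sequence π = (n−1, 3^2, 2^{n−3}), consisting of one term n−1, two terms 3, and n−3 terms 2, is potentially (K_5 − P_4)-graphic. -/
/-- The (asymmetric) edge relation away from the hub `0`: the path `3-1-2-4` and the matching
`5-6, 7-8, ...`. -/
def wheelRel (i j : ℕ) : Prop :=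
  (i = 1 ∧ j = 2) ∨ (i = 1 ∧ j = 3) ∨ (i = 2 ∧ j = 4) ∨ (5 ≤ i ∧ i % 2 = 1 ∧ j = i + 1)

/-- The realization: hub `0` joined to everything, plus the edges of `wheelRel`. -/
def hubGraph (N : ℕ) : SimpleGraph (Fin N) where
  Adj i j := i ≠ j ∧ (i.val = 0 ∨ j.val = 0 ∨ wheelRel i.val j.val ∨ wheelRel j.val i.val)
  symm := ⟨by
    rintro i j ⟨h, h'⟩
    exact ⟨h.symm, by tauto⟩⟩
  loopless := ⟨fun i h => h.1 rfl⟩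

lemma degMS_eq_of (L : List ℕ) (G : SimpleGraph (Fin L.length))
    (h : ∀ i, Nat.card {w // G.Adj i w} = L.get i) : degMS G = ↑L := by
  unfold degMS
  simp only [h]
  rw [Fin.univ_val_map, List.ofFn_get]

lemma card_of {N : ℕ} (G : SimpleGraph (Fin N)) (i : Fin N) (s : Finset (Fin N))
    (h : ∀ w, G.Adj i w ↔ w ∈ s) : Nat.card {w // G.Adj i w} = s.card := by
  simp only [h]
  simp

set_option maxHeartbeats 2000000 in
lemma hub_card (N : ℕ) (hN : 7 ≤ N) (hodd : N % 2 = 1) (i : Fin N) :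
    Nat.card {w // (hubGraph N).Adj i w} =
      if i.val = 0 then N - 1 else if i.val ≤ 2 then 3 else 2 := by
  have pair : ∀ a : ℕ, ∀ ha : a < N, a ≠ 0 →
      (∀ w : Fin N, (hubGraph N).Adj i w ↔ (w.val = 0 ∨ w.val = a)) →
      Nat.card {w // (hubGraph N).Adj i w} = 2 := by
    intro a ha h0 h
    rw [card_of _ i {⟨0, by omega⟩, ⟨a, ha⟩} (by intro w; rw [h]; simp [Fin.ext_iff])]
    rw [Finset.card_pair]
    simp [Fin.ext_iff]; omega
  have triple : ∀ a b : ℕ, ∀ ha : a < N, ∀ hb : b < N, a ≠ 0 → b ≠ 0 → a ≠ b →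
      (∀ w : Fin N, (hubGraph N).Adj i w ↔ (w.val = 0 ∨ w.val = a ∨ w.val = b)) →
      Nat.card {w // (hubGraph N).Adj i w} = 3 := by
    intro a b ha hb h0 h1 h2 h
    rw [card_of _ i {⟨0, by omega⟩, ⟨a, ha⟩, ⟨b, hb⟩} (by intro w; rw [h]; simp [Fin.ext_iff])]
    rw [Finset.card_eq_three]
    refine ⟨_, _, _, ?_, ?_, ?_, rfl⟩ <;> simp [Fin.ext_iff] <;> omega
  obtain ⟨i, hi⟩ := i
  by_cases c0 : i = 0
  · rw [card_of _ _ (Finset.univ.erase ⟨i, hi⟩)]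
    · simp [c0]
    · rintro ⟨w, hw⟩
      simp [hubGraph, c0, Fin.ext_iff]
      omega
  by_cases c1 : i = 1
  · rw [triple 2 3] <;> first | omega | skip
    · simp [c1]
    · rintro ⟨w, hw⟩
      simp only [hubGraph, wheelRel, ne_eq, Fin.ext_iff]; omega
  by_cases c2 : i = 2
  · rw [triple 1 4] <;> first | omega | skip
    · simp [c2]
    · rintro ⟨w, hw⟩
      simp only [hubGraph, wheelRel, ne_eq, Fin.ext_iff]; omega
  have hc : (if i = 0 then N - 1 else if i ≤ 2 then 3 else 2) = 2 := by
    rw [if_neg c0, if_neg (by omega)]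
  refine Eq.trans ?_ hc.symm
  clear hc
  by_cases c3 : i = 3
  · apply pair 1 (by omega) (by omega)
    rintro ⟨w, hw⟩
    simp only [hubGraph, wheelRel, ne_eq, Fin.ext_iff]; omega
  by_cases c4 : i = 4
  · apply pair 2 (by omega) (by omega)
    rintro ⟨w, hw⟩
    simp only [hubGraph, wheelRel, ne_eq, Fin.ext_iff]; omega
  by_cases c5 : i % 2 = 1
  · apply pair (i + 1) (by omega) (by omega)
    rintro ⟨w, hw⟩
    simp only [hubGraph, wheelRel, ne_eq, Fin.ext_iff]; omega
  · apply pair (i - 1) (by omega) (by omega)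
    rintro ⟨w, hw⟩
    simp only [hubGraph, wheelRel, ne_eq, Fin.ext_iff]; omega

theorem potentially_K5P4_odd_seq (n : ℕ) (hn : 7 ≤ n) (hodd : Odd n) :
    Potentially K5P4 ((n - 1) :: 3 :: 3 :: List.replicate (n - 3) 2) := by
  have hl : ((n - 1) :: 3 :: 3 :: List.replicate (n - 3) 2).length = n := by
    simp; omega
  have ho : n % 2 = 1 := Nat.odd_iff.mp hodd
  refine ⟨hubGraph _, degMS_eq_of _ _ ?_, ?_⟩
  · intro i
    rw [hub_card _ (by omega) (by omega) i]
    obtain ⟨i, hi⟩ := i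
    match i, hi with
    | 0, _ => simp; omega
    | 1, _ => simp
    | 2, _ => simp
    | k + 3, _ => simp
  · refine ⟨fun k => ⟨![1, 4, 3, 2, 0] k, ?_⟩, ?_, ?_⟩
    · rw [hl]
      fin_cases k <;> simp <;> omega
    · intro a b h
      fin_cases a <;> fin_cases b <;> simp_all
    · intro u v h
      fin_cases u <;> fin_cases v <;> simp_all [K5P4, hubGraph, wheelRel]
end

section
/- Let d be an even integer with d ≥ 4 and let n ≥ 6 with d ≤ n − 1. Then the n-term sequence π = (d, 3^2, 2^{n−3}), consisting of one term d, two terms 3, and n−3 terms 2, is potentially (K_5 − Y_4)-graphic. -/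
/-- Graph on `Fin N` from an oriented edge relation on `ℕ`. -/
def mkG (N : ℕ) (E : ℕ → ℕ → Prop) (hE : ∀ i j, E i j → i < j) : SimpleGraph (Fin N) where
  Adj u v := E u v ∨ E v u
  symm := ⟨fun _ _ h => h.symm⟩
  loopless := ⟨fun _ h => by rcases h with h | h <;> exact absurd (hE _ _ h) (lt_irrefl _)⟩

theorem card_mkG (N : ℕ) (E : ℕ → ℕ → Prop) (hE : ∀ i j, E i j → i < j) (v : Fin N)
    (s : Finset ℕ) (hs : ∀ w, w ∈ s ↔ w < N ∧ (E v w ∨ E w v)) :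
    Nat.card {w // (mkG N E hE).Adj v w} = s.card := by
  rw [show s.card = Nat.card (s : Set ℕ) by simp]
  refine Nat.card_congr ⟨fun w => ⟨w.1.1, ?_⟩, fun w => ⟨⟨w.1, ?_⟩, ?_⟩, ?_, ?_⟩
  · exact Finset.mem_coe.2 ((hs _).2 ⟨w.1.2, w.2⟩)
  · exact ((hs _).1 (Finset.mem_coe.1 w.2)).1
  · exact ((hs _).1 (Finset.mem_coe.1 w.2)).2
  · intro w; rfl
  · intro w; rfl

theorem degMS_eq (π : List ℕ) (G : SimpleGraph (Fin π.length))
    (h : ∀ v, Nat.card {w // G.Adj v w} = π.get v) : degMS G = ↑π := by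
  unfold degMS
  simp only [h]
  have : (Finset.univ : Finset (Fin π.length)).val = ↑(List.finRange π.length) := rfl
  rw [this, Multiset.map_coe, ← List.ofFn_eq_map, List.ofFn_get]

theorem get_seq (d m : ℕ) (v : Fin (d :: 3 :: 3 :: List.replicate m 2).length) :
    (d :: 3 :: 3 :: List.replicate m 2).get v =
      if v.1 = 0 then d else if v.1 ≤ 2 then 3 else 2 := by
  obtain ⟨v, hv⟩ := v
  match v with
  | 0 => simp
  | 1 => simp
  | 2 => simp
  | k + 3 => simp

theorem reduce (d n : ℕ) (hn : 6 ≤ n) (E : ℕ → ℕ → Prop) (hE : ∀ i j, E i j → i < j)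
    (h : ∀ v, v < n → ∃ s : Finset ℕ, (∀ w, w ∈ s ↔ w < n ∧ (E v w ∨ E w v)) ∧
      s.card = if v = 0 then d else if v ≤ 2 then 3 else 2)
    (f : Fin 5 → ℕ) (hf : ∀ i, f i < n) (hi : Function.Injective f)
    (hadj : ∀ u v, K5Y4.Adj u v → E (f u) (f v) ∨ E (f v) (f u)) :
    Potentially K5Y4 (d :: 3 :: 3 :: List.replicate (n - 3) 2) := by
  have hl : (d :: 3 :: 3 :: List.replicate (n - 3) 2).length = n := by
    simp only [List.length_cons, List.length_replicate]; omega
  refine ⟨mkG _ E hE, degMS_eq _ _ ?_, fun i => ⟨f i, lt_of_lt_of_eq (hf i) hl.symm⟩, ?_, ?_⟩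
  · intro v
    obtain ⟨s, hs, hc⟩ := h v.1 (lt_of_lt_of_eq v.2 hl)
    rw [get_seq, ← hc]
    apply card_mkG
    intro w
    rw [hs w]
    exact and_congr_left fun _ => by rw [hl]
  · intro a b hab
    exact hi (congrArg Fin.val hab)
  · intro u v huv
    exact hadj u v huv

theorem adj_aux (f : Fin 5 → ℕ) (R : ℕ → ℕ → Prop)
    (h04 : R (f 0) (f 4) ∨ R (f 4) (f 0)) (h12 : R (f 1) (f 2) ∨ R (f 2) (f 1))
    (h13 : R (f 1) (f 3) ∨ R (f 3) (f 1)) (h14 : R (f 1) (f 4) ∨ R (f 4) (f 1))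
    (h23 : R (f 2) (f 3) ∨ R (f 3) (f 2)) (h24 : R (f 2) (f 4) ∨ R (f 4) (f 2)) :
    ∀ u v, K5Y4.Adj u v → R (f u) (f v) ∨ R (f v) (f u) := by
  intro u v h
  simp only [K5Y4, SimpleGraph.sdiff_adj, SimpleGraph.top_adj, SimpleGraph.fromEdgeSet_adj] at h
  fin_cases u <;> fin_cases v <;> first
    | assumption
    | (apply Or.symm; assumption)
    | (exfalso; revert h; simp)

/-- Case `d ≤ n - 2`. -/
def E1 (d n i j : ℕ) : Prop :=
  (i = 0 ∧ j < n ∧ (j = 1 ∨ j = 2 ∨ (4 ≤ j ∧ j ≤ d) ∨ j + 1 = n)) ∨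
  (i = 1 ∧ j = 2) ∨ (i = 1 ∧ j = 3) ∨ (i = 2 ∧ j = 3) ∨
  (4 ≤ i ∧ j = i + 1 ∧ j < n ∧ (i % 2 = 0 ∨ d ≤ i))

/-- Case `d = n - 1`. -/
def E2 (n i j : ℕ) : Prop :=
  (i = 0 ∧ 0 < j ∧ j < n) ∨
  (i = 1 ∧ j = 2) ∨ (i = 1 ∧ j = 3) ∨ (i = 2 ∧ j = 4) ∨
  (5 ≤ i ∧ j = i + 1 ∧ j < n ∧ i % 2 = 1)

theorem three (a b c : ℕ) (h : a < b) (h' : b < c) : ({a, b, c} : Finset ℕ).card = 3 := by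
  rw [Finset.card_eq_three]; exact ⟨a, b, c, by omega, by omega, by omega, rfl⟩

theorem two (a b : ℕ) (h : a < b) : ({a, b} : Finset ℕ).card = 2 :=
  Finset.card_pair (by omega)

theorem case1 (d n : ℕ) (hd : 4 ≤ d) (he : d % 2 = 0) (hn : 6 ≤ n) (hdn : d + 2 ≤ n) :
    Potentially K5Y4 (d :: 3 :: 3 :: List.replicate (n - 3) 2) := by
  refine reduce d n hn (E1 d n) (by intro i j; unfold E1; omega) ?_ ![4, 1, 2, 3, 0] ?_ ?_ ?_
  · intro v hv
    by_cases h0 : v = 0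
    · refine ⟨insert 1 (insert 2 (insert (n - 1) (Finset.Icc 4 d))), ?_, ?_⟩
      · intro w; simp only [Finset.mem_insert, Finset.mem_Icc, E1]; constructor <;> grind
      · rw [Finset.card_insert_of_notMem, Finset.card_insert_of_notMem,
          Finset.card_insert_of_notMem, Nat.card_Icc, if_pos h0]
        all_goals first | omega | (simp only [Finset.mem_insert, Finset.mem_Icc]; omega)
    rw [if_neg h0]
    by_cases h1 : v = 1
    · refine ⟨{0, 2, 3}, ?_, by subst h1; rfl⟩
      intro w; simp only [Finset.mem_insert, Finset.mem_singleton, E1]; constructor <;> grind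
    by_cases h2 : v = 2
    · refine ⟨{0, 1, 3}, ?_, by subst h2; rfl⟩
      intro w; simp only [Finset.mem_insert, Finset.mem_singleton, E1]; constructor <;> grind
    rw [if_neg (by omega)]
    have key : ∃ a b, a < b ∧ ∀ w, (w = a ∨ w = b) ↔ w < n ∧ (E1 d n v w ∨ E1 d n w v) := by
      unfold E1
      by_cases h3 : v = 3
      · exact ⟨1, 2, by omega, by intro w; constructor <;> grind⟩
      by_cases h4 : v + 1 = n
      · exact ⟨0, v - 1, by omega, by intro w; constructor <;> grind⟩
      by_cases h5 : d < v
      · exact ⟨v - 1, v + 1, by omega, by intro w; constructor <;> grind⟩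
      by_cases h6 : v % 2 = 0
      · exact ⟨0, v + 1, by omega, by intro w; constructor <;> grind⟩
      · exact ⟨0, v - 1, by omega, by intro w; constructor <;> grind⟩
    obtain ⟨a, b, hab, h⟩ := key
    exact ⟨{a, b}, by simpa using h, two a b hab⟩
  · intro i; fin_cases i <;> simp <;> omega
  · decide
  · apply adj_aux <;> simp [E1] <;> omega

theorem case2 (d n : ℕ) (he : d % 2 = 0) (hn : 6 ≤ n) (hdn : d + 1 = n) :
    Potentially K5Y4 (d :: 3 :: 3 :: List.replicate (n - 3) 2) := by
  refine reduce d n hn (E2 n) (by intro i j; unfold E2; omega) ?_ ![4, 0, 1, 3, 2] ?_ ?_ ?_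
  · intro v hv
    by_cases h0 : v = 0
    · refine ⟨Finset.Icc 1 d, ?_, ?_⟩
      · intro w; simp only [Finset.mem_Icc, E2]; constructor <;> grind
      · rw [Nat.card_Icc, if_pos h0]; omega
    rw [if_neg h0]
    by_cases h1 : v = 1
    · refine ⟨{0, 2, 3}, ?_, by subst h1; rfl⟩
      intro w; simp only [Finset.mem_insert, Finset.mem_singleton, E2]; constructor <;> grind
    by_cases h2 : v = 2
    · refine ⟨{0, 1, 4}, ?_, by subst h2; rfl⟩
      intro w; simp only [Finset.mem_insert, Finset.mem_singleton, E2]; constructor <;> grind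
    rw [if_neg (by omega)]
    have key : ∃ a b, a < b ∧ ∀ w, (w = a ∨ w = b) ↔ w < n ∧ (E2 n v w ∨ E2 n w v) := by
      unfold E2
      by_cases h3 : v = 3
      · exact ⟨0, 1, by omega, by intro w; constructor <;> grind⟩
      by_cases h4 : v = 4
      · exact ⟨0, 2, by omega, by intro w; constructor <;> grind⟩
      by_cases h6 : v % 2 = 1
      · exact ⟨0, v + 1, by omega, by intro w; constructor <;> grind⟩
      · exact ⟨0, v - 1, by omega, by intro w; constructor <;> grind⟩
    obtain ⟨a, b, hab, h⟩ := key
    exact ⟨{a, b}, by simpa using h, two a b hab⟩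
  · intro i; fin_cases i <;> simp <;> omega
  · decide
  · apply adj_aux <;> simp [E2] <;> omega

theorem potentially_K5Y4_d33_seq (d n : ℕ) (hd : 4 ≤ d) (heven : Even d)
    (hn : 6 ≤ n) (hdn : d ≤ n - 1) :
    Potentially K5Y4 (d :: 3 :: 3 :: List.replicate (n - 3) 2) := by
  have he : d % 2 = 0 := Nat.even_iff.1 heven
  by_cases h : d + 1 = n
  · exact case2 d n he hn h
  · exact case1 d n hd he hn (by omega)
end

section
/- For every n ≥ 5, the n-term sequence π = (3^4, 2^{n−4}), consisting of four terms 3 and n−4 terms 2, is potentially (K_5 − Y_4)-graphic. -/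
/-- Directed edges of the realization: `K₄` minus an edge, with the ends `2`, `3` of the missing
edge joined by the path `3, 4, ..., m-1, 2`. -/
def arcRel (m a b : ℕ) : Prop :=
  (a = 0 ∧ 1 ≤ b ∧ b ≤ 3) ∨ (a = 1 ∧ 2 ≤ b ∧ b ≤ 3) ∨ (3 ≤ a ∧ b = a + 1) ∨ (a = 2 ∧ b + 1 = m)

def realG (m : ℕ) (hm : 5 ≤ m) : SimpleGraph (Fin m) where
  Adj a b := arcRel m a b ∨ arcRel m b a
  symm := ⟨fun _ _ h => h.symm⟩
  loopless := ⟨fun a h => by unfold arcRel at h; omega⟩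

theorem card_three {m : ℕ} (p : Fin m → Prop) (a b c : ℕ) (ha : a < m) (hb : b < m) (hc : c < m)
    (hab : a ≠ b) (hac : a ≠ c) (hbc : b ≠ c)
    (h : ∀ w : Fin m, p w ↔ (w : ℕ) = a ∨ (w : ℕ) = b ∨ (w : ℕ) = c) :
    Nat.card {w // p w} = 3 := by
  rw [Nat.subtype_card ({⟨a, ha⟩, ⟨b, hb⟩, ⟨c, hc⟩} : Finset (Fin m))
    (by intro w; simp [h, Fin.ext_iff])]
  exact Finset.card_eq_three.2 ⟨_, _, _, by simpa using hab, by simpa using hac,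
    by simpa using hbc, rfl⟩

theorem card_two {m : ℕ} (p : Fin m → Prop) (a b : ℕ) (ha : a < m) (hb : b < m)
    (hab : a ≠ b) (h : ∀ w : Fin m, p w ↔ (w : ℕ) = a ∨ (w : ℕ) = b) :
    Nat.card {w // p w} = 2 := by
  rw [Nat.subtype_card ({⟨a, ha⟩, ⟨b, hb⟩} : Finset (Fin m))
    (by intro w; simp [h, Fin.ext_iff])]
  exact Finset.card_eq_two.2 ⟨_, _, by simpa using hab, rfl⟩

theorem realG_deg (m : ℕ) (hm : 5 ≤ m) (v : Fin m) :
    Nat.card {w // (realG m hm).Adj v w} = if (v : ℕ) < 4 then 3 else 2 := by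
  obtain ⟨v, hv⟩ := v
  simp only [realG, arcRel]
  split_ifs with h
  · have : v = 0 ∨ v = 1 ∨ v = 2 ∨ v = 3 := by omega
    rcases this with rfl | rfl | rfl | rfl
    · refine card_three _ 1 2 3 ?_ ?_ ?_ ?_ ?_ ?_ ?_ <;> omega
    · refine card_three _ 0 2 3 ?_ ?_ ?_ ?_ ?_ ?_ ?_ <;> omega
    · refine card_three _ 0 1 (m - 1) ?_ ?_ ?_ ?_ ?_ ?_ ?_ <;> omega
    · refine card_three _ 0 1 4 ?_ ?_ ?_ ?_ ?_ ?_ ?_ <;> omega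
  · by_cases h2 : v + 1 = m
    · refine card_two _ (v - 1) 2 ?_ ?_ ?_ ?_ <;> omega
    · refine card_two _ (v - 1) (v + 1) ?_ ?_ ?_ ?_ <;> omega

theorem potentially_K5Y4_3333_seq (n : ℕ) (hn : 5 ≤ n) :
    Potentially K5Y4 (List.replicate 4 3 ++ List.replicate (n - 4) 2) := by
  have hl : 5 ≤ (List.replicate 4 3 ++ List.replicate (n - 4) 2).length := by
    simp only [List.length_append, List.length_replicate]; omega
  have hg : ∀ v : Fin (List.replicate 4 3 ++ List.replicate (n - 4) 2).length,
      (if (v : ℕ) < 4 then 3 else 2) =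
        (List.replicate 4 3 ++ List.replicate (n - 4) 2).get v := by
    intro v
    simp only [List.get_eq_getElem, List.getElem_append, List.getElem_replicate,
      List.length_replicate, dite_eq_ite]
  generalize (List.replicate 4 3 ++ List.replicate (n - 4) 2) = l at hl hg
  refine ⟨realG _ hl, ?_, ![⟨4, by omega⟩, ⟨0, by omega⟩, ⟨1, by omega⟩, ⟨2, by omega⟩,
    ⟨3, by omega⟩], ?_, ?_⟩
  · unfold degMS
    simp only [realG_deg, hg]
    rw [Fin.univ_val_map, List.ofFn_get]
  · intro a b
    fin_cases a <;> fin_cases b <;> simp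
  · intro a b
    fin_cases a <;> fin_cases b <;> simp [K5Y4, realG, arcRel]
end
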